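/- arXiv:2205.08691 — 6 statements merged into one kernel-verified Lean document; each statement's English description precedes it below -/
import Mathlib

section
/- Let X be a subshift over a finite alphabet whose complexity function p satisfies p(q+1) > p(q) for every q (equivalently, X is aperiodic), and suppose there is a constant d such that p(q) <= q + d for infinitely many q. Then X is quasi-Sturmian: there exists a constant c such that p(q) = q + c for all sufficiently large q. -/
/-- `w` is a finite word occurring as a factor (contiguous subword) of some `x ∈ X`. -/
def SubshiftFactor {A : Type*} (X : Set (ℤ → A)) (w : List A) : Prop :=
  ∃ x ∈ X, ∃ k : ℤ, ∀ i : Fin w.length, x (k + (i : ℕ)) = w.get i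

/-- The complexity function of `X`: the number of words of length `q` in the language of `X`. -/
noncomputable def subComplexity {A : Type*} (X : Set (ℤ → A)) (q : ℕ) : ℕ :=
  Set.ncard {w : List A | w.length = q ∧ SubshiftFactor X w}

/-- A strictly increasing sequence of naturals with `p q ≤ q + d` for infinitely many `q`
eventually has the form `q + c`. -/
theorem StrictMono.eventually_eq_add_of_frequently_le {p : ℕ → ℕ} (hp : StrictMono p) (d : ℕ)
    (hio : ∀ N : ℕ, ∃ q, N ≤ q ∧ p q ≤ q + d) :
    ∃ c : ℕ, ∃ N : ℕ, ∀ q, N ≤ q → p q = q + c := by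
  have hid : ∀ q, q ≤ p q := fun _ => hp.le_apply
  have hmono : Monotone fun q => p q - q := monotone_nat_of_le_succ fun q => by
    have := hp (Nat.lt_succ_self q)
    grind
  have hbound : ∀ q, p q - q ≤ d := fun q => by
    obtain ⟨r, hqr, hr⟩ := hio q
    have : p q - q ≤ p r - r := hmono hqr
    omega
  obtain ⟨N, hN⟩ : ∃ N, ∀ q, d - (p N - N) ≤ d - (p q - q) :=
    ⟨_, fun q => Function.argmin_le (fun q => d - (p q - q)) q⟩
  refine ⟨p N - N, N, fun q hq => ?_⟩
  have hle : p N - N ≤ p q - q := hmono hq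
  have := hid q
  have := hbound q
  have := hN q
  omega

/-- If an aperiodic subshift (i.e. one whose complexity is strictly increasing) over a finite
alphabet satisfies `p(q) ≤ q + d` for infinitely many `q`, then it is quasi-Sturmian:
`p(q) = q + c` for some constant `c` and all sufficiently large `q`. -/
theorem stmt0 {A : Type*} [Fintype A] [TopologicalSpace A] [DiscreteTopology A]
    (X : Set (ℤ → A)) (hclosed : IsClosed X)
    (hinv : ∀ x ∈ X, (fun n => x (n + 1)) ∈ X)
    (hinv' : ∀ x ∈ X, (fun n => x (n - 1)) ∈ X)
    (haper : ∀ q : ℕ, subComplexity X q < subComplexity X (q + 1))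
    (d : ℕ) (hio : ∀ N : ℕ, ∃ q, N ≤ q ∧ subComplexity X q ≤ q + d) :
    ∃ c : ℕ, ∃ N : ℕ, ∀ q, N ≤ q → subComplexity X q = q + c := by
  exact (strictMono_nat_of_lt_succ haper).eventually_eq_add_of_frequently_le d hio
end

section
/- Fix N in N. Define a new cut sequence and spacer sequence by: r~_n = r_n and s~_{n,i} = s_{n,i} for n < N; r~_N = (r_N + 1)(r_{N+1} + 1) - 1, and for 0 <= a <= r_{N+1}, s~_{N, a(r_N+1) + b} = s_{N,b} for 0 <= b < r_N and s~_{N, a(r_N+1) + r_N} = s_{N,r_N} + s_{N+1,a}; and r~_n = r_{n+1}, s~_{n,i} = s_{n+1,i} for n > N. Then the word sequence B~ built from (r~, s~) satisfies B~_n = B_n for all n <= N and B~_n = B_{n+1} for all n > N; in particular the two rank-one word sequences generate the same language. -/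
/-- The rank-one word sequence: `B 1 = 0` and `B (n+1) = ∏_{i=0}^{r n} B n 1^{s n i}`
over the alphabet `{0,1}` (encoded as `Bool` with `false = 0`, `true = 1`).
The value at `0` is an irrelevant placeholder. -/
def Bseq (r : ℕ → ℕ) (s : ℕ → ℕ → ℕ) : ℕ → List Bool
  | 0 => [false]
  | 1 => [false]
  | n + 2 =>
      ((List.range (r (n + 1) + 1)).map
        (fun i => Bseq r s (n + 1) ++ List.replicate (s (n + 1) i) true)).flatten

/-- The language of the rank-one subshift: all factors of some `B n`. -/
def InLang (r : ℕ → ℕ) (s : ℕ → ℕ → ℕ) (w : List Bool) : Prop :=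
  ∃ n, w <:+: Bseq r s n

/-- The word `∏_{i<k} w 1^{f i}`. -/
def spacedPower (w : List Bool) (f : ℕ → ℕ) (k : ℕ) : List Bool :=
  ((List.range k).map (fun i => w ++ List.replicate (f i) true)).flatten

theorem Bseq_succ (r : ℕ → ℕ) (s : ℕ → ℕ → ℕ) {n : ℕ} (hn : 1 ≤ n) :
    Bseq r s (n + 1) = spacedPower (Bseq r s n) (s n) (r n + 1) := by
  obtain ⟨m, rfl⟩ := Nat.exists_eq_add_of_le' hn
  rfl

theorem spacedPower_add (w : List Bool) (f : ℕ → ℕ) (k l : ℕ) :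
    spacedPower w f (k + l) = spacedPower w f k ++ spacedPower w (fun i => f (k + i)) l := by
  simp [spacedPower, List.range_add, Function.comp_def]

theorem spacedPower_succ (w : List Bool) (f : ℕ → ℕ) (k : ℕ) :
    spacedPower w f (k + 1) = spacedPower w f k ++ (w ++ List.replicate (f k) true) := by
  simp [spacedPower, List.range_succ]

theorem spacedPower_congr (w : List Bool) {f g : ℕ → ℕ} {k : ℕ} (h : ∀ i < k, f i = g i) :
    spacedPower w f k = spacedPower w g k := by
  unfold spacedPower
  congr 1
  refine List.map_congr_left fun i hi => ?_
  rw [h i (List.mem_range.mp hi)]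

/-- A spaced power of a spaced power is a single spaced power. -/
theorem spacedPower_mul (w : List Bool) (f g h : ℕ → ℕ) (k m : ℕ)
    (hlt : ∀ a < m, ∀ b < k, h (a * (k + 1) + b) = f b)
    (hlast : ∀ a < m, h (a * (k + 1) + k) = f k + g a) :
    spacedPower w h (m * (k + 1)) = spacedPower (spacedPower w f (k + 1)) g m := by
  induction m with
  | zero => simp [spacedPower]
  | succ m ih =>
    rw [Nat.succ_mul, spacedPower_add,
      ih (fun a ha => hlt a (by omega)) (fun a ha => hlast a (by omega)),
      spacedPower_succ _ g m, spacedPower_succ w (fun i => h (m * (k + 1) + i)) k,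
      spacedPower_succ w f k,
      spacedPower_congr w (hlt m (by omega)), hlast m (by omega), List.replicate_add]
    simp only [List.append_assoc]

theorem Bseq_isInfix_succ (r : ℕ → ℕ) (s : ℕ → ℕ → ℕ) {n : ℕ} (hn : 1 ≤ n) :
    Bseq r s n <:+: Bseq r s (n + 1) := by
  rw [Bseq_succ r s hn, spacedPower_succ]
  exact (List.prefix_append _ _).isInfix.trans (List.suffix_append _ _).isInfix

/-- Collapsing stages `N` and `N+1` of a rank-one construction into a single stage
produces the word sequence `B~` with `B~ n = B n` for `n ≤ N` and `B~ n = B (n+1)`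
for `n > N`; in particular the two constructions generate the same language. -/
theorem stmt3 (r r' : ℕ → ℕ) (s s' : ℕ → ℕ → ℕ) (hr : ∀ n, 1 ≤ r n)
    (N : ℕ) (hN : 1 ≤ N)
    (hr1 : ∀ n, n < N → r' n = r n)
    (hs1 : ∀ n, n < N → ∀ i, s' n i = s n i)
    (hrN : r' N = (r N + 1) * (r (N + 1) + 1) - 1)
    (hsNa : ∀ a, a ≤ r (N + 1) → ∀ b, b < r N → s' N (a * (r N + 1) + b) = s N b)
    (hsNb : ∀ a, a ≤ r (N + 1) →
      s' N (a * (r N + 1) + r N) = s N (r N) + s (N + 1) a)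
    (hr2 : ∀ n, N < n → r' n = r (n + 1))
    (hs2 : ∀ n, N < n → ∀ i, s' n i = s (n + 1) i) :
    (∀ n, n ≤ N → Bseq r' s' n = Bseq r s n) ∧
      (∀ n, N < n → Bseq r' s' n = Bseq r s (n + 1)) ∧
      (∀ w : List Bool, InLang r' s' w ↔ InLang r s w) := by
  have hle : ∀ n, n ≤ N → Bseq r' s' n = Bseq r s n := by
    intro n
    induction n with
    | zero => intro _; rfl
    | succ n ih =>
      intro hn
      rcases Nat.eq_zero_or_pos n with rfl | hpos
      · rfl
      · rw [Bseq_succ _ _ hpos, Bseq_succ _ _ hpos, ih (by omega), hr1 n (by omega)]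
        exact spacedPower_congr _ fun i _ => hs1 n (by omega) i
  have hgt : ∀ n, N < n → Bseq r' s' n = Bseq r s (n + 1) := by
    intro n hn
    induction n, hn using Nat.le_induction with
    | base =>
      have hcount : r' N + 1 = (r (N + 1) + 1) * (r N + 1) := by
        rw [hrN, Nat.sub_add_cancel (Nat.mul_pos (Nat.succ_pos _) (Nat.succ_pos _)), mul_comm]
      rw [Nat.succ_eq_add_one, Bseq_succ r' s' hN, Bseq_succ r s (Nat.le_add_left 1 N),
        Bseq_succ r s hN, hle N le_rfl, hcount]
      exact spacedPower_mul _ _ _ _ _ _ (fun a ha => hsNa a (by omega))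
        (fun a ha => hsNb a (by omega))
    | succ n hn ih =>
      rw [Bseq_succ r' s' (by omega), Bseq_succ r s (Nat.le_add_left 1 n), ih, hr2 n hn]
      exact spacedPower_congr _ fun i _ => hs2 n hn i
  refine ⟨hle, hgt, fun w => ⟨?_, ?_⟩⟩
  · rintro ⟨n, hw⟩
    rcases Nat.lt_or_ge N n with hn | hn
    · exact ⟨n + 1, hgt n hn ▸ hw⟩
    · exact ⟨n, hle n hn ▸ hw⟩
  · rintro ⟨n, hw⟩
    rcases Nat.lt_or_ge N n with hn | hn
    · refine ⟨n, ?_⟩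
      rw [hgt n hn]
      exact hw.trans (Bseq_isInfix_succ r s (by omega))
    · exact ⟨n, (hle n hn).symm ▸ hw⟩
end

section
/- Suppose there are N in N and nonnegative integers c < d such that for all n >= N: s_{n,i} is in {c, d} for all 0 <= i < r_n with both values occurring, and s_{n,r_n} = 0. Then there exists a cut sequence r~ and spacer sequence s~ whose word sequence generates the same language, such that for all sufficiently large n: s~_{n,r~_n} = 0 and s~_{n,i} is in {0, d-c} for all 0 <= i < r~_n with both values occurring. -/
/-- The word `B (n+2)` with its last factor split off. -/
theorem Bseq_succ_s5 (r : ℕ → ℕ) (s : ℕ → ℕ → ℕ) (n : ℕ) :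
    Bseq r s (n + 2) =
      ((List.range (r (n + 1))).map
        (fun i => Bseq r s (n + 1) ++ List.replicate (s (n + 1) i) true)).flatten ++
      (Bseq r s (n + 1) ++ List.replicate (s (n + 1) (r (n + 1))) true) := by
  simp [Bseq, List.range_succ]

/-- `B (n+1)` starts with `B n` followed by any number of `1`s not exceeding `s n 0`. -/
theorem Bseq_append_replicate_prefix (r : ℕ → ℕ) (s : ℕ → ℕ → ℕ) (n k : ℕ)
    (hk : k ≤ s (n + 1) 0) :
    Bseq r s (n + 1) ++ List.replicate k true <+: Bseq r s (n + 2) := by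
  obtain ⟨m, hm⟩ := Nat.exists_eq_add_of_le hk
  simp only [Bseq, List.range_succ_eq_map, List.map_cons, List.flatten_cons, hm,
    List.replicate_add]
  simp only [List.append_assoc, List.prefix_append_right_inj]
  exact List.prefix_append _ _

/-- Spacers that agree with `s` below level `M`, append `1^c` at the end of level `M`, and are
lowered by `c` above level `M`. -/
def shiftSpacer (r : ℕ → ℕ) (s : ℕ → ℕ → ℕ) (c M n i : ℕ) : ℕ :=
  if n < M then s n i
  else if n = M then (if i = r n then c else s n i)
  else s n i - c

theorem Bseq_shiftSpacer_of_le (r : ℕ → ℕ) (s : ℕ → ℕ → ℕ) (c M : ℕ) :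
    ∀ n ≤ M, Bseq r (shiftSpacer r s c M) n = Bseq r s n
  | 0, _ => rfl
  | 1, _ => rfl
  | n + 2, h => by
    have hn : n + 1 < M := h
    simp [Bseq, Bseq_shiftSpacer_of_le r s c M (n + 1) hn.le, shiftSpacer, hn]

theorem Bseq_shiftSpacer_of_lt (r : ℕ → ℕ) (s : ℕ → ℕ → ℕ) (c M : ℕ)
    (hs : ∀ n, M ≤ n → (∀ i < r n, c ≤ s n i) ∧ s n (r n) = 0) (hM : 1 ≤ M) :
    ∀ n, M < n →
      Bseq r (shiftSpacer r s c M) n = Bseq r s n ++ List.replicate c true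
  | 0, h => absurd h (by omega)
  | 1, h => absurd h (by omega)
  | n + 2, h => by
    obtain ⟨hc, h0⟩ := hs (n + 1) (by omega)
    rw [Bseq_succ_s5, Bseq_succ_s5, h0, List.replicate_zero, List.append_nil, List.append_assoc]
    rcases (show M = n + 1 ∨ M < n + 1 by omega) with hn | hn
    · rw [Bseq_shiftSpacer_of_le r s c M (n + 1) hn.ge]
      congr 2
      · refine List.map_congr_left fun i hi => ?_
        have hi' := List.mem_range.1 hi
        simp [shiftSpacer, hn, hi'.ne]
      · simp [shiftSpacer, hn]
    · rw [Bseq_shiftSpacer_of_lt r s c M hs hM (n + 1) hn]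
      have h1 : ¬ n + 1 < M := by omega
      have h2 : n + 1 ≠ M := by omega
      have hlast : shiftSpacer r s c M (n + 1) (r (n + 1)) = 0 := by
        simp [shiftSpacer, h1, h2, h0]
      rw [hlast, List.replicate_zero, List.append_nil]
      congr 2
      refine List.map_congr_left fun i hi => ?_
      have hi' := hc i (List.mem_range.1 hi)
      rw [shiftSpacer, if_neg h1, if_neg h2, List.append_assoc, ← List.replicate_add,
        Nat.add_sub_cancel' hi']

/-- If for all sufficiently large `n` the spacers satisfy `s_{n,i} ∈ {c,d}` for `0 ≤ i < r_n`
(with both values occurring) and `s_{n,r_n} = 0`, where `c < d`, then there is a rank-one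
word sequence generating the same language whose spacers eventually lie in `{0, d-c}`
over `0 ≤ i < r_n` (with both values occurring) and vanish at `i = r_n`. -/
theorem stmt5 (r : ℕ → ℕ) (s : ℕ → ℕ → ℕ) (hr : ∀ n, 1 ≤ r n)
    (c d : ℕ) (hcd : c < d) (N : ℕ)
    (hyp : ∀ n, N ≤ n →
      (∀ i, i < r n → s n i = c ∨ s n i = d) ∧
      (∃ i, i < r n ∧ s n i = c) ∧ (∃ i, i < r n ∧ s n i = d) ∧
      s n (r n) = 0) :
    ∃ (r' : ℕ → ℕ) (s' : ℕ → ℕ → ℕ), (∀ n, 1 ≤ r' n) ∧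
      (∀ w : List Bool, InLang r' s' w ↔ InLang r s w) ∧
      ∃ M : ℕ, ∀ n, M ≤ n →
        s' n (r' n) = 0 ∧
        (∀ i, i < r' n → s' n i = 0 ∨ s' n i = d - c) ∧
        (∃ i, i < r' n ∧ s' n i = 0) ∧ (∃ i, i < r' n ∧ s' n i = d - c) := by
  have hs : ∀ n, N + 1 ≤ n → (∀ i < r n, c ≤ s n i) ∧ s n (r n) = 0 := fun n hn =>
    ⟨fun i hi => by rcases (hyp n (by omega)).1 i hi with h | h <;> omega,
      (hyp n (by omega)).2.2.2⟩
  have hlt := Bseq_shiftSpacer_of_lt r s c (N + 1) hs (by omega)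
  refine ⟨r, shiftSpacer r s c (N + 1), hr, fun w => ⟨?_, ?_⟩, N + 2, fun n hn => ?_⟩
  · rintro ⟨n, hw⟩
    rcases le_or_gt n (N + 1) with hn | hn
    · exact ⟨n, Bseq_shiftSpacer_of_le r s c (N + 1) n hn ▸ hw⟩
    · obtain ⟨m, rfl⟩ : ∃ m, n = m + 1 := ⟨n - 1, by omega⟩
      rw [hlt _ hn] at hw
      exact ⟨m + 2, hw.trans (Bseq_append_replicate_prefix r s m c
        ((hs (m + 1) hn.le).1 0 (hr _))).isInfix⟩
  · rintro ⟨n, hw⟩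
    rcases le_or_gt n (N + 1) with hn | hn
    · exact ⟨n, (Bseq_shiftSpacer_of_le r s c (N + 1) n hn).symm ▸ hw⟩
    · exact ⟨n, hlt n hn ▸ hw.trans (List.prefix_append _ _).isInfix⟩
  · have hval : ∀ i, shiftSpacer r s c (N + 1) n i = s n i - c := fun i => by
      rw [shiftSpacer, if_neg (by omega), if_neg (by omega)]
    simp only [hval]
    obtain ⟨hall, ⟨i, hi, hic⟩, ⟨j, hj, hjd⟩, h0⟩ := hyp n (by omega)
    exact ⟨by omega, fun k hk => by rcases hall k hk with h | h <;> omega,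
      ⟨i, hi, by omega⟩, ⟨j, hj, by omega⟩⟩
end

section
/- Let N be such that s_{m,r_m} = 0 for all m >= N, and let d >= 1 be an integer. Then there exists a constant c >= 1 such that for all n >= N and every length l with h_n + c <= l <= 2 h_n, the suffix of length l of B_n B_n is different from the suffix of length l of B_n 1^d B_n. -/
/-- The suffix of length `l` of a word `w`. -/
def suffixOf (w : List Bool) (l : ℕ) : List Bool := w.drop (w.length - l)

theorem Bseq_suffix_of_le {r : ℕ → ℕ} {s : ℕ → ℕ → ℕ} {N : ℕ} (hN : 1 ≤ N)
    (hlast : ∀ m, N ≤ m → s m (r m) = 0) {n : ℕ} (hn : N ≤ n) :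
    Bseq r s N <:+ Bseq r s n := by
  induction n, hn using Nat.le_induction with
  | base => exact List.suffix_rfl
  | succ m hm ih =>
    refine ih.trans ?_
    obtain ⟨k, rfl⟩ : ∃ k, m = k + 1 := ⟨m - 1, by omega⟩
    rw [Bseq, List.range_succ]
    simp only [List.map_append, List.map_singleton, List.flatten_append, List.flatten_singleton,
      hlast _ hm, List.replicate_zero, List.append_nil]
    exact List.suffix_append _ _

theorem exists_Bseq_eq_cons (r : ℕ → ℕ) (s : ℕ → ℕ → ℕ) (n : ℕ) :
    ∃ t, Bseq r s n = false :: t := by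
  induction n with
  | zero => exact ⟨[], rfl⟩
  | succ n ih =>
    cases n with
    | zero => exact ⟨[], rfl⟩
    | succ n =>
      obtain ⟨t, ht⟩ := ih
      rw [Bseq, List.range_succ_eq_map, ht]
      simp

theorem reverse_suffixOf (w : List Bool) (l : ℕ) :
    (suffixOf w l).reverse = w.reverse.take l := by
  rw [suffixOf, List.take_reverse]

/-- A word agreeing on its first `k` letters with its shift by a nonempty block of `1`s
consists of `1`s there. -/
theorem getElem?_eq_some_true_of_take_eq {R : List Bool} {d k : ℕ} (hd : 1 ≤ d)
    (h : R.take k = (List.replicate d true ++ R).take k) (i : ℕ) (hi : i < k) :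
    R[i]? = some true := by
  induction i using Nat.strong_induction_on with
  | _ i ih =>
    have h' := congrArg (fun L => L[i]?) h
    simp only [List.getElem?_take, hi, if_true] at h'
    rw [h']
    by_cases hid : i < d
    · rw [List.getElem?_append_left (by simpa using hid)]
      simp [hid]
    · rw [List.getElem?_append_right (by simpa using hid), List.length_replicate]
      exact ih _ (by omega) (by omega)

/-- If `s_{m,r_m} = 0` for all `m ≥ N` and `d ≥ 1`, then there is a constant `c ≥ 1`
such that for all `n ≥ N` and every `l` with `h_n + c ≤ l ≤ 2 h_n`, the suffixes of
length `l` of `B_n B_n` and of `B_n 1^d B_n` differ. -/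
theorem stmt6 (r : ℕ → ℕ) (s : ℕ → ℕ → ℕ) (hr : ∀ n, 1 ≤ r n)
    (N : ℕ) (hN : 1 ≤ N) (hlast : ∀ m, N ≤ m → s m (r m) = 0)
    (d : ℕ) (hd : 1 ≤ d) :
    ∃ c : ℕ, 1 ≤ c ∧ ∀ n, N ≤ n → ∀ l : ℕ,
      (Bseq r s n).length + c ≤ l → l ≤ 2 * (Bseq r s n).length →
      suffixOf (Bseq r s n ++ Bseq r s n) l ≠
        suffixOf (Bseq r s n ++ List.replicate d true ++ Bseq r s n) l := by
  refine ⟨(Bseq r s N).length + d, by omega, fun n hn l hl _ heq => ?_⟩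
  have h := congrArg List.reverse heq
  simp only [reverse_suffixOf, List.reverse_append, List.reverse_replicate] at h
  obtain ⟨k, rfl⟩ := Nat.exists_eq_add_of_le (Nat.le_of_add_right_le hl)
  have h₂ := congrArg (List.drop (Bseq r s n).length) h
  simp only [List.drop_take, Nat.add_sub_cancel_left] at h₂
  rw [List.drop_left' (by simp), List.drop_left' (by simp)] at h₂
  obtain ⟨u, hu⟩ := Bseq_suffix_of_le hN hlast hn
  obtain ⟨t, ht⟩ := exists_Bseq_eq_cons r s N
  rw [ht, List.length_cons] at hl
  have h₃ := getElem?_eq_some_true_of_take_eq hd h₂ t.length (by omega)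
  rw [← hu, ht] at h₃
  simp at h₃
end

section
/- Assume there are N in N and an integer d >= 1 such that for all n >= N: s_{n,i} is in {0, d} for all 0 <= i < r_n, s_{n,r_n} = 0, and s_{n,i} is not constant over 0 <= i < r_n (both values 0 and d occur). Then for every n >= N the word B_n is right-special. -/
/-- A word `w` is right-special if both `w0` and `w1` belong to the language. -/
def RightSpecial (r : ℕ → ℕ) (s : ℕ → ℕ → ℕ) (w : List Bool) : Prop :=
  InLang r s (w ++ [false]) ∧ InLang r s (w ++ [true])

/-- Consecutive blocks of a concatenation indexed by `List.range m` form a factor of it. -/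
theorem append_succ_infix_flatten_map_range {α : Type*} (f : ℕ → List α) {i m : ℕ}
    (h : i + 1 < m) : f i ++ f (i + 1) <:+: ((List.range m).map f).flatten := by
  induction m with
  | zero => omega
  | succ m ih =>
    rw [List.range_succ, List.map_append, List.flatten_append]
    rcases Nat.lt_succ_iff_lt_or_eq.mp h with h' | rfl
    · exact (ih h').trans (List.infix_append' [] _ _)
    · rw [List.range_succ]
      refine ⟨((List.range i).map f).flatten, [], ?_⟩
      simp

/-- For `i < r n`, the word `B n 1^{s n i} B n` is a factor of `B (n + 1)`. -/
theorem Bseq_append_replicate_append_infix (r : ℕ → ℕ) (s : ℕ → ℕ → ℕ) {n i : ℕ}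
    (hn : 1 ≤ n) (hi : i < r n) :
    Bseq r s n ++ List.replicate (s n i) true ++ Bseq r s n <:+: Bseq r s (n + 1) := by
  obtain ⟨n, rfl⟩ := Nat.exists_eq_add_of_le' hn
  refine List.IsInfix.trans ?_ (append_succ_infix_flatten_map_range
    (fun i => Bseq r s (n + 1) ++ List.replicate (s (n + 1) i) true) (Nat.succ_lt_succ hi))
  exact ⟨[], List.replicate (s (n + 1) (i + 1)) true, by simp⟩

/-- If for all `n ≥ N` the spacers satisfy `s_{n,i} ∈ {0,d}` (`0 ≤ i < r_n`),
`s_{n,r_n} = 0`, and both values `0` and `d` occur (with `d ≥ 1`), then `B_n` is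
right-special for every `n ≥ N`. -/
theorem stmt7 (r : ℕ → ℕ) (s : ℕ → ℕ → ℕ) (hr : ∀ n, 1 ≤ r n)
    (d : ℕ) (hd : 1 ≤ d) (N : ℕ) (hN : 1 ≤ N)
    (hyp : ∀ n, N ≤ n →
      (∀ i, i < r n → s n i = 0 ∨ s n i = d) ∧
      s n (r n) = 0 ∧
      (∃ i, i < r n ∧ s n i = 0) ∧ (∃ i, i < r n ∧ s n i = d)) :
    ∀ n, N ≤ n → RightSpecial r s (Bseq r s n) := by
  intro n hn
  obtain ⟨-, -, ⟨i, hi, hi0⟩, ⟨j, hj, hjd⟩⟩ := hyp n hn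
  have h1 : 1 ≤ n := hN.trans hn
  refine ⟨⟨n + 1, List.IsInfix.trans ?_ (Bseq_append_replicate_append_infix r s h1 hi)⟩,
    ⟨n + 1, List.IsInfix.trans ?_ (Bseq_append_replicate_append_infix r s h1 hj)⟩⟩
  · obtain ⟨t, ht⟩ := exists_Bseq_eq_cons r s n
    exact ⟨[], t, by simp [hi0, ht]⟩
  · obtain ⟨e, rfl⟩ := Nat.exists_eq_add_of_le' hd
    exact ⟨[], List.replicate e true ++ Bseq r s n, by simp [hjd, List.replicate_succ]⟩
end

section
/- Suppose there are N in N and an integer d >= 1 such that for all n >= N: s_{n,i} is in {0, d} for all 0 <= i < r_n, s_{n,r_n} = 0, and s_{n,i} is not constant over 0 <= i < r_n. Then there exists a constant C such that for all sufficiently large n, there exists q_n >= h_n with p(q_n) >= (3/2) q_n + (p(h_n) - h_n) - C. -/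
/-- The word complexity: the number of words of length `q` in the language. -/
noncomputable def complexity (r : ℕ → ℕ) (s : ℕ → ℕ → ℕ) (q : ℕ) : ℕ :=
  Set.ncard {w : List Bool | w.length = q ∧ InLang r s w}

namespace RankOne

/-! ### Counting right special words -/

/-- The number of words of length `q` satisfying `P`. -/
noncomputable def wordCount (P : List Bool → Prop) (q : ℕ) : ℕ :=
  Set.ncard {w : List Bool | w.length = q ∧ P w}

theorem finite_words (P : List Bool → Prop) (q : ℕ) :
    {w : List Bool | w.length = q ∧ P w}.Finite :=
  (List.finite_length_eq Bool q).subset fun _ hw => hw.1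

theorem wordCount_reverse (P : List Bool → Prop) (q : ℕ) :
    wordCount (fun w => P w.reverse) q = wordCount P q := by
  unfold wordCount
  rw [← Set.ncard_image_of_injective {w : List Bool | w.length = q ∧ P w}
    List.reverse_injective]
  congr 1
  ext w
  simp only [Set.mem_ofPred_eq, Set.mem_image]
  constructor
  · rintro ⟨h1, h2⟩
    exact ⟨w.reverse, ⟨by simpa using h1, h2⟩, by simp⟩
  · rintro ⟨v, ⟨h1, h2⟩, rfl⟩
    exact ⟨by simpa using h1, by simpa using h2⟩

/-- `w` is right special if both one-letter extensions satisfy `P`. -/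
def RightSpecial (P : List Bool → Prop) (w : List Bool) : Prop :=
  ∀ c, P (w ++ [c])

theorem RightSpecial.of_suffix {P : List Bool → Prop}
    (hP : ∀ ⦃u w⦄, u <:+: w → P w → P u) {u w : List Bool} (h : u <:+ w)
    (hw : RightSpecial P w) : RightSpecial P u := by
  intro c
  refine hP ?_ (hw c)
  obtain ⟨a, rfl⟩ := h
  exact ⟨a, [], by simp⟩

theorem wordCount_add_card_le {P : List Bool → Prop} (hext : ∀ w, P w → ∃ c, P (w ++ [c]))
    {l : ℕ} (S : Finset (List Bool)) (hlen : ∀ w ∈ S, w.length = l)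
    (hS : ∀ w ∈ S, RightSpecial P w) :
    wordCount P l + S.card ≤ wordCount P (l + 1) := by
  classical
  choose! e he using hext
  unfold wordCount
  rw [← Set.ncard_coe_finset S,
    ← Set.ncard_image_of_injective (f := fun w => w ++ [e w]) {w | w.length = l ∧ P w}
      (fun a b hab => List.append_inj_left' hab rfl),
    ← Set.ncard_image_of_injective (f := fun w => w ++ [!e w]) (S : Set (List Bool))
      (fun a b hab => List.append_inj_left' hab rfl),
    ← Set.ncard_union_eq _ ((finite_words P l).image _) (S.finite_toSet.image _)]
  · refine Set.ncard_le_ncard ?_ (finite_words P (l + 1))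
    rintro _ (⟨w, ⟨h1, h2⟩, rfl⟩ | ⟨w, hw, rfl⟩)
    · exact ⟨by simp [h1], he w h2⟩
    · exact ⟨by simp [hlen w hw], hS w hw _⟩
  · rw [Set.disjoint_left]
    rintro _ ⟨w, -, rfl⟩ ⟨w', -, h⟩
    have h1 : w' = w := List.append_inj_left' h rfl
    subst h1
    simp at h

theorem append_suffix_append {u w : List Bool} (s : List Bool) (h : u <:+ w) :
    u ++ s <:+ w ++ s := by
  obtain ⟨a, rfl⟩ := h
  exact ⟨a, by simp⟩

theorem exists_suffix_of_length {w : List Bool} {l : ℕ} (h : l ≤ w.length) :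
    ∃ u, u <:+ w ∧ u.length = l :=
  ⟨w.drop (w.length - l), List.drop_suffix _ _, by simp; omega⟩

theorem wordCount_succ_of_branch {P : List Bool → Prop}
    (hP : ∀ ⦃u w⦄, u <:+: w → P w → P u) (hext : ∀ w, P w → ∃ c, P (w ++ [c]))
    {T W R : List Bool} {x : Bool} (hT : RightSpecial P T) (hW : RightSpecial P W)
    (hTR : (!x) :: R <:+ T) (hWR : x :: R <:+ W) {l : ℕ} (hR : R.length < l)
    (hlT : l ≤ T.length) (hlW : l ≤ W.length) :
    wordCount P l + 2 ≤ wordCount P (l + 1) := by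
  obtain ⟨t, ht, rfl⟩ := exists_suffix_of_length hlT
  obtain ⟨w, hw, hwl⟩ := exists_suffix_of_length hlW
  have h1 : (!x) :: R <:+ t := List.suffix_of_suffix_length_le hTR ht (by simpa using hR)
  have h2 : x :: R <:+ w := List.suffix_of_suffix_length_le hWR hw (by simp; omega)
  have hne : t ≠ w := by
    rintro rfl
    have := (List.suffix_of_suffix_length_le h1 h2 (by simp)).eq_of_length (by simp)
    simp at this
  have := wordCount_add_card_le hext {t, w} (l := t.length) (by simp [hwl]) (by
    intro u hu
    simp only [Finset.mem_insert, Finset.mem_singleton] at hu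
    rcases hu with rfl | rfl
    exacts [hT.of_suffix hP ht, hW.of_suffix hP hw])
  rwa [Finset.card_pair hne] at this

/-! ### Concatenations of a block with spacers -/

/-- The spacer `1^d` for the letter `true` and the empty spacer for `false`. -/
def spacer (d : ℕ) (c : Bool) : List Bool := List.replicate (if c then d else 0) true

/-- Copies of the block `B`, separated by the spacers prescribed by a word. -/
def spell (B : List Bool) (d : ℕ) : List Bool → List Bool
  | [] => B
  | c :: w => B ++ (spacer d c ++ spell B d w)

theorem spell_append (B : List Bool) (d : ℕ) (u w : List Bool) (c : Bool) :
    spell B d (u ++ c :: w) = spell B d u ++ (spacer d c ++ spell B d w) := by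
  induction u with
  | nil => rfl
  | cons a u ih => simp [spell, ih]

theorem spell_suffix (B : List Bool) (d : ℕ) {u w : List Bool} (h : u <:+ w) :
    spell B d u <:+ spell B d w := by
  obtain ⟨a, rfl⟩ := h
  rcases List.eq_nil_or_concat a with rfl | ⟨a, c, rfl⟩
  · simp
  · exact ⟨spell B d a ++ spacer d c, by simp [spell_append]⟩

theorem spell_prefix (B : List Bool) (d : ℕ) {u w : List Bool} (h : u <+: w) :
    spell B d u <+: spell B d w := by
  obtain ⟨a, rfl⟩ := h
  cases a with
  | nil => simp
  | cons c a => exact ⟨spacer d c ++ spell B d a, by simp [spell_append]⟩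

theorem spell_infix (B : List Bool) (d : ℕ) {u w : List Bool} (h : u <:+: w) :
    spell B d u <:+: spell B d w := by
  obtain ⟨a, b, rfl⟩ := h
  exact (spell_suffix B d (List.suffix_append a u)).isInfix.trans
    (spell_prefix B d (List.prefix_append (a ++ u) b)).isInfix

theorem block_suffix_spell (B : List Bool) (d : ℕ) (w : List Bool) : B <:+ spell B d w :=
  spell_suffix B d (List.nil_suffix (l := w))

theorem reverse_spell (B : List Bool) (d : ℕ) (w : List Bool) :
    (spell B d w).reverse = spell B.reverse d w.reverse := by
  induction w with
  | nil => rfl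
  | cons c w ih => simp [spell, spell_append, ih, spacer]

theorem length_spell (B : List Bool) (d : ℕ) (w : List Bool) :
    (spell B d w).length = (w.length + 1) * B.length + w.count true * d := by
  induction w with
  | nil => simp [spell]
  | cons c w ih =>
    cases c <;> simp [spell, spacer, ih] <;> ring

/-! ### Towers of spacer words -/

/-- A sequence of spacer words in which each word occurs in the next one as a prefix, as a suffix,
and on both sides of each of the two letters. -/
structure IsTower (V : ℕ → List Bool) : Prop where
  prefix_succ : ∀ m, V m <+: V (m + 1)
  suffix_succ : ∀ m, V m <:+ V (m + 1)
  mid : ∀ m c, V m ++ c :: V m <:+: V (m + 1)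
  mem_zero : ∀ c, c ∈ V 0

/-- The factors of the words of a tower. -/
def SpacerLang (V : ℕ → List Bool) (w : List Bool) : Prop := ∃ m, w <:+: V m

/-- The factors of the words spelled by a tower. -/
def TowerLang (B : List Bool) (d : ℕ) (V : ℕ → List Bool) (w : List Bool) : Prop :=
  ∃ m, w <:+: spell B d (V m)

section Tower

variable {B : List Bool} {d : ℕ} {V : ℕ → List Bool}

theorem SpacerLang.of_infix {u w : List Bool} (h : u <:+: w) (hw : SpacerLang V w) :
    SpacerLang V u :=
  hw.imp fun _ hm => h.trans hm

theorem TowerLang.of_infix ⦃u w : List Bool⦄ (h : u <:+: w) (hw : TowerLang B d V w) :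
    TowerLang B d V u :=
  hw.imp fun _ hm => h.trans hm

theorem SpacerLang.spell {w : List Bool} (hw : SpacerLang V w) :
    TowerLang B d V (spell B d w) :=
  hw.imp fun _ hm => spell_infix B d hm

theorem IsTower.reverse (hV : IsTower V) : IsTower fun m => (V m).reverse where
  prefix_succ m := List.reverse_prefix.2 (hV.suffix_succ m)
  suffix_succ m := List.reverse_suffix.2 (hV.prefix_succ m)
  mid m c := by simpa using List.reverse_infix.2 (hV.mid m c)
  mem_zero c := by simpa using hV.mem_zero c

theorem spacerLang_reverse {w : List Bool} :
    SpacerLang (fun m => (V m).reverse) w ↔ SpacerLang V w.reverse := by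
  unfold SpacerLang
  refine exists_congr fun m => ?_
  rw [← List.reverse_infix, List.reverse_reverse]

theorem towerLang_reverse :
    TowerLang B.reverse d (fun m => (V m).reverse) = fun w => TowerLang B d V w.reverse := by
  funext w
  unfold TowerLang
  refine propext (exists_congr fun m => ?_)
  rw [← reverse_spell, ← List.reverse_infix, List.reverse_reverse]

theorem IsTower.suffix_of_le (hV : IsTower V) {m n : ℕ} (h : m ≤ n) : V m <:+ V n := by
  induction n, h using Nat.le_induction with
  | base => exact List.suffix_rfl
  | succ n _ ih => exact ih.trans (hV.suffix_succ n)

theorem IsTower.le_length (hV : IsTower V) (m : ℕ) : m ≤ (V m).length := by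
  induction m with
  | zero => simp
  | succ m ih =>
    have := (hV.mid m true).length_le
    simp at this
    omega

theorem IsTower.spacerLang_mid (hV : IsTower V) (m : ℕ) (c : Bool) :
    SpacerLang V (V m ++ c :: V m) := ⟨m + 1, hV.mid m c⟩

theorem IsTower.exists_concat (hV : IsTower V) (hB : B ≠ []) {w : List Bool}
    (hw : TowerLang B d V w) : ∃ c, TowerLang B d V (w ++ [c]) := by
  obtain ⟨m, a, b, h⟩ := hw
  cases b with
  | cons c b => exact ⟨c, m, a, b, by simpa using h⟩
  | nil =>
    obtain ⟨c, s, hs⟩ : ∃ c s, spell B d (V m) = c :: s := by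
      refine List.exists_cons_of_ne_nil fun h0 => hB ?_
      simpa [h0] using block_suffix_spell B d (V m)
    refine ⟨c, m + 1, List.IsInfix.trans ⟨a, s, ?_⟩ (spell_infix B d (hV.mid m false))⟩
    rw [spell_append]
    nth_rewrite 1 [← h]
    simp [spacer, hs]

/-- A tower of spacer words, together with a block that starts with `1^t₁ 0` and ends with
`0 1^t₂`, and a spacer of positive length. -/
structure IsTowerSystem (B : List Bool) (d : ℕ) (V : ℕ → List Bool) (t₁ t₂ : ℕ) : Prop where
  tower : IsTower V
  pos : 1 ≤ d
  block_prefix : List.replicate t₁ true ++ [false] <+: B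
  block_suffix : false :: List.replicate t₂ true <:+ B

variable {t₁ t₂ : ℕ}

namespace IsTowerSystem

theorem reverse (hS : IsTowerSystem B d V t₁ t₂) :
    IsTowerSystem B.reverse d (fun m => (V m).reverse) t₂ t₁ where
  tower := hS.tower.reverse
  pos := hS.pos
  block_prefix := by simpa using List.reverse_prefix.2 hS.block_suffix
  block_suffix := by simpa using List.reverse_suffix.2 hS.block_prefix

theorem block_ne_nil (hS : IsTowerSystem B d V t₁ t₂) : B ≠ [] := by
  rintro rfl
  simpa using hS.block_prefix.length_le

theorem rightSpecial_spell (hS : IsTowerSystem B d V t₁ t₂) {w : List Bool}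
    (hw : RightSpecial (SpacerLang V) w) :
    RightSpecial (TowerLang B d V) (spell B d w ++ List.replicate t₁ true) := by
  intro c
  refine TowerLang.of_infix (List.IsPrefix.isInfix ?_) (hw c).spell
  rw [spell_append, List.append_assoc, List.prefix_append_right_inj]
  cases c with
  | false => simpa [spacer, spell] using hS.block_prefix
  | true =>
    obtain ⟨e, rfl⟩ := Nat.exists_eq_add_of_le' hS.pos
    obtain ⟨b, hb⟩ := hS.block_prefix
    refine ⟨List.replicate e true ++ ([false] ++ b), ?_⟩
    simp only [spacer, spell, if_true, ← hb]
    simp only [← List.append_assoc, List.append_left_inj, List.replicate_append_replicate,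
      show [true] = List.replicate 1 true from rfl]
    congr 1
    omega

theorem cons_suffix_spell (hS : IsTowerSystem B d V t₁ t₂) (c : Bool) {z w : List Bool}
    (h : c :: z <:+ w) : c :: (List.replicate t₂ true ++ spell B d z) <:+ spell B d w := by
  obtain ⟨u, rfl⟩ := h
  obtain ⟨b, hb⟩ := hS.block_suffix.trans (block_suffix_spell B d u)
  rw [spell_append, ← List.append_assoc, ← List.cons_append, ← hb]
  refine append_suffix_append _ ?_
  cases c with
  | false => exact ⟨b, by simp [spacer]⟩
  | true =>
    obtain ⟨e, rfl⟩ := Nat.exists_eq_add_of_le' hS.pos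
    refine ⟨b ++ false :: List.replicate e true, ?_⟩
    simp only [spacer, if_true, ← List.replicate_succ, List.append_assoc, List.cons_append,
      List.replicate_append_replicate]
    congr 3
    omega

theorem exists_long_suffix (hS : IsTowerSystem B d V t₁ t₂) (m q : ℕ) :
    ∃ n, V m <:+ V n ∧ q ≤ (spell B d (V n)).length := by
  refine ⟨max m q, hS.tower.suffix_of_le (le_max_left _ _), ?_⟩
  have h1 := hS.tower.le_length (max m q)
  have h2 : 1 ≤ B.length := List.length_pos_iff.2 hS.block_ne_nil
  rw [length_spell]
  have h3 := Nat.mul_le_mul (h1.trans (Nat.le_succ _)) h2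
  have h4 := le_max_right m q
  simp only [Nat.succ_eq_add_one] at h3
  omega

theorem rightSpecial_tower (hS : IsTowerSystem B d V t₁ t₂) (m : ℕ) :
    RightSpecial (SpacerLang V) (V m) := fun c =>
  (hS.tower.spacerLang_mid m c).of_infix ⟨[], V m, by simp⟩

theorem wordCount_mono (hS : IsTowerSystem B d V t₁ t₂) {a b : ℕ} (hab : a ≤ b) :
    wordCount (TowerLang B d V) a + b ≤ wordCount (TowerLang B d V) b + a := by
  induction b, hab using Nat.le_induction with
  | base => rfl
  | succ b _ ih =>
    obtain ⟨n, -, hn⟩ := hS.exists_long_suffix 0 b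
    obtain ⟨u, hu, hul⟩ := exists_suffix_of_length hn
    have hT := (hS.rightSpecial_spell (hS.rightSpecial_tower n)).of_suffix TowerLang.of_infix
      (u := u ++ List.replicate t₁ true) (append_suffix_append _ hu)
    obtain ⟨v, hv, hvl⟩ := exists_suffix_of_length
      (w := u ++ List.replicate t₁ true) (l := b) (by simp; omega)
    have := wordCount_add_card_le (P := TowerLang B d V)
      (fun w hw => hS.tower.exists_concat hS.block_ne_nil hw) {v} (by simpa using hvl)
      (by simpa using hT.of_suffix TowerLang.of_infix hv)
    simp at this
    omega

/-- If a right special spacer word branches off the tower at `z`, then the complexity grows with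
slope two after the length of the word spelled by `z`. -/
theorem gain (hS : IsTowerSystem B d V t₁ t₂) {x : Bool} {z w : List Bool} {m q : ℕ}
    (hw : RightSpecial (SpacerLang V) w) (hxw : x :: z <:+ w) (hm : (!x) :: z <:+ V m)
    (hzq : (spell B d z).length ≤ q) (hqw : q ≤ (spell B d w).length) :
    wordCount (TowerLang B d V) (spell B d z).length + 2 * q ≤
      wordCount (TowerLang B d V) q + 2 * (spell B d z).length + (t₁ + t₂ + 1) := by
  set R := List.replicate t₂ true ++ spell B d z ++ List.replicate t₁ true with hR
  have hRlen : R.length = (spell B d z).length + (t₁ + t₂) := by simp [hR]; omega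
  obtain ⟨n, hn, hnq⟩ := hS.exists_long_suffix m q
  have hWR : x :: R <:+ spell B d w ++ List.replicate t₁ true := by
    rw [hR, ← List.cons_append]
    exact append_suffix_append _ <| hS.cons_suffix_spell x hxw
  have hTR : (!x) :: R <:+ spell B d (V n) ++ List.replicate t₁ true := by
    rw [hR, ← List.cons_append]
    exact append_suffix_append _ <| hS.cons_suffix_spell (!x) (hm.trans hn)
  have key : ∀ b, R.length + 1 ≤ b → b ≤ q →
      wordCount (TowerLang B d V) (R.length + 1) + 2 * b ≤
        wordCount (TowerLang B d V) b + 2 * (R.length + 1) := by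
    intro b hb
    induction b, hb using Nat.le_induction with
    | base => simp
    | succ b hb ih =>
      intro hbq
      have h1 := ih (by omega)
      have h2 := wordCount_succ_of_branch TowerLang.of_infix
        (fun w hw => hS.tower.exists_concat hS.block_ne_nil hw)
        (hS.rightSpecial_spell (hS.rightSpecial_tower n)) (hS.rightSpecial_spell hw) hTR hWR
        (l := b) (by omega) (by simp; omega) (by simp; omega)
      omega
  by_cases h : R.length + 1 ≤ q
  · have h1 := key q h le_rfl
    have h2 := hS.wordCount_mono (a := (spell B d z).length) (b := R.length + 1) (by omega)
    omega
  · have h2 := hS.wordCount_mono hzq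
    omega

end IsTowerSystem

/-! ### Runs in spacer words -/

theorem eq_append_run_of_mem {y : Bool} {v : List Bool} (h : y ∈ v) :
    ∃ a k, v = a ++ y :: List.replicate k (!y) := by
  induction v using List.reverseRecOn with
  | nil => simp at h
  | append_singleton v c ih =>
    by_cases hc : c = y
    · exact ⟨v, 0, by simp [hc]⟩
    · obtain ⟨a, k, rfl⟩ := ih (by simpa [Ne.symm hc] using h)
      refine ⟨a, k + 1, ?_⟩
      rw [Bool.eq_not_of_ne hc, List.replicate_succ']
      simp

theorem eq_run_append_of_mem {y : Bool} {v : List Bool} (h : y ∈ v) :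
    ∃ a k, v = List.replicate k (!y) ++ y :: a := by
  obtain ⟨a, k, h⟩ := eq_append_run_of_mem (List.mem_reverse.2 h)
  exact ⟨a.reverse, k, by simpa using congrArg List.reverse h⟩

theorem eq_run_of_notMem {y : Bool} {v : List Bool} (h : y ∉ v) :
    v = List.replicate v.length (!y) :=
  List.eq_replicate_iff.2 ⟨rfl, fun _ hc => Bool.eq_not_of_ne fun hcy => h (hcy ▸ hc)⟩

theorem replicate_infix_of_infix_append_cons {x y : Bool} (hxy : x ≠ y) {n : ℕ}
    {a b : List Bool} (h : List.replicate n x <:+: a ++ y :: b) :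
    List.replicate n x <:+: a ∨ List.replicate n x <:+: b := by
  induction a with
  | nil =>
    rw [List.nil_append, List.infix_cons_iff] at h
    rcases h with h | h
    · cases n with
      | zero => simp
      | succ n =>
        rw [List.replicate_succ, List.cons_prefix_cons] at h
        exact absurd h.1 hxy
    · exact Or.inr h
  | cons _ a ih =>
    rw [List.cons_append, List.infix_cons_iff] at h
    rcases h with h | h
    · left
      rw [← List.cons_append] at h
      obtain ⟨k, hk⟩ := h
      rcases List.append_eq_append_iff.1 hk with ⟨s, h1, -⟩ | ⟨s, h1, h2⟩
      · exact ⟨[], s, by simpa using h1.symm⟩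
      · cases s with
        | nil => exact ⟨[], [], by simpa using h1⟩
        | cons e s =>
          simp only [List.cons_append, List.cons.injEq] at h2
          have := List.eq_of_mem_replicate (h1 ▸ List.mem_append_right _ List.mem_cons_self :
            e ∈ List.replicate n x)
          exact absurd (this.symm.trans h2.1.symm) hxy
    · exact (ih h).imp_left List.infix_cons

/-- `m + 1` runs of `i` letters `!y`, separated by single letters `y`. -/
def periodicRun (y : Bool) (i : ℕ) : ℕ → List Bool
  | 0 => List.replicate i (!y)
  | m + 1 => List.replicate i (!y) ++ y :: periodicRun y i m

theorem periodicRun_append (y : Bool) (i a b : ℕ) :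
    periodicRun y i a ++ y :: periodicRun y i b = periodicRun y i (a + b + 1) := by
  induction a with
  | zero => simp [periodicRun]
  | succ a ih => simp [periodicRun, ih, show a + 1 + b = a + b + 1 by omega]

theorem reverse_periodicRun (y : Bool) (i m : ℕ) :
    (periodicRun y i m).reverse = periodicRun y i m := by
  induction m with
  | zero => simp [periodicRun]
  | succ m ih => simpa [periodicRun, ih] using periodicRun_append y i m 0

theorem exists_cons_periodicRun_suffix {y : Bool} {i : ℕ} {v : List Bool}
    (hgap : ∀ k < i, ¬ y :: (List.replicate k (!y) ++ [y]) <:+: v) {a : List Bool} {m : ℕ}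
    (hv : v = a ++ y :: periodicRun y i m) (ha : List.replicate (i + 1) (!y) <:+: a) :
    ∃ j, 1 ≤ j ∧ (!y) :: periodicRun y i j <:+ v := by
  have key : ∀ m k, i + 1 ≤ k → (!y) :: periodicRun y i (m + 1) <:+
      List.replicate k (!y) ++ y :: periodicRun y i m := by
    intro m k hk
    refine ⟨List.replicate (k - (i + 1)) (!y), ?_⟩
    rw [periodicRun, ← List.cons_append, ← List.replicate_succ, ← List.append_assoc,
      List.replicate_append_replicate]
    congr 2
    omega
  induction h : a.length using Nat.strong_induction_on generalizing a m with
  | _ n ih =>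
  by_cases hy : y ∈ a
  · obtain ⟨a', k, rfl⟩ := eq_append_run_of_mem hy
    rcases lt_trichotomy k i with hk | rfl | hk
    · exact absurd ⟨a', periodicRun y i m, by simp [hv]⟩ (hgap k hk)
    · have ha' : List.replicate (k + 1) (!y) <:+: a' := by
        refine (replicate_infix_of_infix_append_cons (by simp) ha).resolve_right fun h => ?_
        simpa using h.length_le
      have hv' : v = a' ++ y :: periodicRun y k (m + 1) := by simpa [periodicRun] using hv
      exact ih a'.length (by simp [← h]) hv' ha' rfl
    · exact ⟨m + 1, by omega, (key m k hk).trans ⟨a' ++ [y], by simp [hv]⟩⟩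
  · rw [eq_run_of_notMem hy] at hv
    refine ⟨m + 1, by omega, hv ▸ key m _ ?_⟩
    simpa using ha.length_le

/-! ### Complexity growth -/

/-- From length `|B|` on, the complexity grows at some point by as much as `3 / 2` times the
length, up to a bounded error. -/
def FastGrowth (B : List Bool) (d : ℕ) (V : ℕ → List Bool) (K : ℕ) : Prop :=
  ∃ q, B.length ≤ q ∧ 3 * q + 2 * wordCount (TowerLang B d V) B.length ≤
    2 * wordCount (TowerLang B d V) q + 2 * B.length + 4 * K

theorem FastGrowth.of_reverse {K : ℕ}
    (h : FastGrowth B.reverse d (fun m => (V m).reverse) K) : FastGrowth B d V K := by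
  simpa only [FastGrowth, towerLang_reverse, wordCount_reverse, List.length_reverse] using h

theorem length_spell_append_cons (u w : List Bool) (c : Bool) :
    (spell B d (u ++ c :: w)).length =
      (spell B d u).length + (spacer d c).length + (spell B d w).length := by
  simp [spell_append, add_assoc]

theorem length_spell_replicate (k : ℕ) (c : Bool) :
    (spell B d (List.replicate k c)).length =
      (k + 1) * B.length + k * (spacer d c).length := by
  induction k with
  | zero => simp [spell]
  | succ k ih =>
    simp only [List.replicate_succ, spell, List.length_append, ih]
    ring

theorem length_spell_periodicRun (y : Bool) (i m : ℕ) :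
    (spell B d (periodicRun y i m)).length =
      (m + 1) * (spell B d (List.replicate i (!y))).length + m * (spacer d y).length := by
  induction m with
  | zero => simp [periodicRun]
  | succ m ih =>
    rw [periodicRun, length_spell_append_cons, ih]
    ring

theorem rightSpecial_of_not {P : List Bool → Prop} {w : List Bool} (y : Bool)
    (h1 : P (w ++ [y])) (h2 : P (w ++ [!y])) : RightSpecial P w := by
  intro c
  rcases Bool.eq_or_eq_not c y with rfl | rfl
  exacts [h1, h2]

namespace IsTowerSystem

theorem fastGrowth_of_periodicRun (hS : IsTowerSystem B d V t₁ t₂) {y : Bool} {i j j' : ℕ}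
    (hi : 1 ≤ i) (hj : 1 ≤ j) (hjj : j ≤ j')
    (hgap : SpacerLang V (y :: (List.replicate (2 * i + 1) (!y) ++ [y])))
    (h0 : y :: List.replicate i (!y) <:+ V 0)
    (h1 : (!y) :: periodicRun y i j <:+ V 1) (h2 : periodicRun y i j' ++ [!y] <+: V 1) :
    FastGrowth B d V (t₁ + t₂ + 1) := by
  have hrun : SpacerLang V (periodicRun y i (j + j' + 1) ++ [!y]) := by
    obtain ⟨a, ha⟩ := h1
    obtain ⟨b, hb⟩ := h2
    refine (hS.tower.spacerLang_mid 1 y).of_infix ⟨a ++ [!y], b, ?_⟩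
    rw [← periodicRun_append]
    nth_rewrite 1 [← ha]
    rw [← hb]
    simp
  have g1 := hS.gain (x := !y) (z := List.replicate i (!y)) (w := List.replicate (2 * i) (!y))
    (m := 0) (q := (spell B d (List.replicate (2 * i) (!y))).length)
    (rightSpecial_of_not y
      (hgap.of_infix ⟨[y, !y], [], by simp [List.replicate_succ]⟩)
      (hgap.of_infix ⟨[y], [y], by simp [List.replicate_succ']⟩))
    ⟨List.replicate (i - 1) (!y), by
      rw [← List.replicate_succ, List.replicate_append_replicate]; congr 1; omega⟩
    (by simpa using h0) (spell_suffix B d ⟨List.replicate i (!y), by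
      rw [List.replicate_append_replicate, two_mul]⟩).length_le le_rfl
  have hsuf : y :: periodicRun y i j <:+ periodicRun y i (2 * j) :=
    ⟨periodicRun y i (j - 1), by rw [periodicRun_append]; congr 1; omega⟩
  have g2 := hS.gain (x := y) (z := periodicRun y i j) (w := periodicRun y i (2 * j))
    (m := 1) (q := (spell B d (periodicRun y i (2 * j))).length)
    (rightSpecial_of_not y
      (hrun.of_infix ⟨[], periodicRun y i (j' - j) ++ [!y], by
        rw [show j + j' + 1 = 2 * j + (j' - j) + 1 by omega, ← periodicRun_append]; simp⟩)
      (hrun.of_infix ⟨periodicRun y i (j' - j) ++ [y], [], by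
        rw [show j + j' + 1 = (j' - j) + 2 * j + 1 by omega, ← periodicRun_append]; simp⟩))
    hsuf h1 (spell_suffix B d ((List.suffix_cons _ _).trans hsuf)).length_le le_rfl
  have m1 := hS.wordCount_mono (block_suffix_spell B d (List.replicate i (!y))).length_le
  have e1 : 2 * (spell B d (periodicRun y i j)).length =
      (spell B d (periodicRun y i (2 * j))).length +
      (spell B d (List.replicate i (!y))).length := by
    simp only [length_spell_periodicRun]
    ring
  have e2 : 3 * (spell B d (List.replicate i (!y))).length ≤
      2 * (spell B d (List.replicate (2 * i) (!y))).length := by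
    simp only [length_spell_replicate]
    nlinarith [Nat.mul_le_mul_right B.length hi,
      Nat.zero_le (i * (spacer d (!y)).length)]
  have e3 : (spell B d (List.replicate (2 * i) (!y))).length ≤
      2 * (spell B d (List.replicate i (!y))).length := by
    simp only [length_spell_replicate]
    nlinarith
  have e4 : 2 * (spell B d (List.replicate i (!y))).length ≤
      (spell B d (periodicRun y i j)).length := by
    rw [length_spell_periodicRun]
    nlinarith [Nat.mul_le_mul_right (spell B d (List.replicate i (!y))).length hj]
  have m2 := hS.wordCount_mono (a := (spell B d (List.replicate (2 * i) (!y))).length)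
    (b := (spell B d (periodicRun y i j)).length) (by omega)
  refine ⟨_, (block_suffix_spell B d (periodicRun y i (2 * j))).length_le, ?_⟩
  omega

theorem cons_replicate_mid {y : Bool} {i j : ℕ} {a b : List Bool} (hS : IsTowerSystem B d V t₁ t₂)
    (hpre : V 0 = List.replicate i (!y) ++ y :: b) (hsuf : V 0 = a ++ y :: List.replicate j (!y))
    (c : Bool) :
    y :: (List.replicate j (!y) ++ c :: (List.replicate i (!y) ++ [y])) <:+: V 1 := by
  refine List.IsInfix.trans ⟨a, b, ?_⟩ (hS.tower.mid 0 c)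
  nth_rewrite 1 [hsuf]
  rw [hpre]
  simp

theorem exists_periodicRun {y : Bool} {i : ℕ} {a b : List Bool} (hS : IsTowerSystem B d V t₁ t₂)
    (hgap : ∀ k < i, ¬ SpacerLang V (y :: (List.replicate k (!y) ++ [y])))
    (hpre : V 0 = List.replicate i (!y) ++ y :: b)
    (hsuf : V 0 = a ++ y :: List.replicate i (!y)) :
    ∃ j, 1 ≤ j ∧ (!y) :: periodicRun y i j <:+ V 1 := by
  obtain ⟨a', ha'⟩ := hS.tower.suffix_succ 0
  have hV : V 1 = a' ++ a ++ y :: List.replicate i (!y) := by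
    rw [List.append_assoc, ← hsuf, ha']
  refine exists_cons_periodicRun_suffix (fun k hk h => hgap k hk ⟨1, h⟩) (m := 0) hV ?_
  have h : List.replicate (i + 1) (!y) <:+: V 1 :=
    List.IsInfix.trans ⟨[y], List.replicate i (!y) ++ [y], by simp [List.replicate_succ']⟩
      (hS.cons_replicate_mid hpre hsuf (!y))
  rw [hV] at h
  refine (replicate_infix_of_infix_append_cons (by simp) h).resolve_right fun h => ?_
  simpa using h.length_le

theorem fastGrowth_of_gaps {y : Bool} {i : ℕ} {a b : List Bool} (hS : IsTowerSystem B d V t₁ t₂)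
    (hi : 1 ≤ i) (hgap : ∀ k < i, ¬ SpacerLang V (y :: (List.replicate k (!y) ++ [y])))
    (hpre : V 0 = List.replicate i (!y) ++ y :: b)
    (hsuf : V 0 = a ++ y :: List.replicate i (!y)) :
    FastGrowth B d V (t₁ + t₂ + 1) := by
  have hpre' : (V 0).reverse = List.replicate i (!y) ++ y :: a.reverse := by simp [hsuf]
  have hsuf' : (V 0).reverse = b.reverse ++ y :: List.replicate i (!y) := by simp [hpre]
  have hgap' : ∀ k < i, ¬ SpacerLang (fun m => (V m).reverse)
      (y :: (List.replicate k (!y) ++ [y])) := by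
    intro k hk
    rw [spacerLang_reverse]
    simpa using hgap k hk
  have hmid : SpacerLang V (y :: (List.replicate (2 * i + 1) (!y) ++ [y])) := by
    refine ⟨1, ?_⟩
    have := hS.cons_replicate_mid hpre hsuf (!y)
    rwa [← List.cons_append (a := !y), ← List.replicate_succ, ← List.append_assoc,
      List.replicate_append_replicate, show i + (i + 1) = 2 * i + 1 by omega] at this
  obtain ⟨j, hj, h1⟩ := hS.exists_periodicRun hgap hpre hsuf
  obtain ⟨j', hj', h2⟩ := hS.reverse.exists_periodicRun hgap' hpre' hsuf'
  rcases le_total j j' with hjj | hjj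
  · refine hS.fastGrowth_of_periodicRun hi hj hjj hmid ⟨a, hsuf.symm⟩ h1 ?_
    simpa [reverse_periodicRun] using List.reverse_prefix.2 h2
  · have h1' := List.reverse_prefix.2 h1
    rw [List.reverse_cons, reverse_periodicRun] at h1'
    rw [add_comm t₁ t₂]
    refine FastGrowth.of_reverse (hS.reverse.fastGrowth_of_periodicRun hi hj' hjj ?_
      ⟨b.reverse, hsuf'.symm⟩ h2 h1')
    rw [spacerLang_reverse]
    simpa using hmid

theorem fastGrowth_of_le {y : Bool} {i j : ℕ} {a b : List Bool} (hS : IsTowerSystem B d V t₁ t₂)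
    (hj : 1 ≤ j) (hji : j ≤ i) (hpre : V 0 = List.replicate i (!y) ++ y :: b)
    (hsuf : V 0 = a ++ y :: List.replicate j (!y)) :
    FastGrowth B d V (t₁ + t₂ + 1) := by
  have hmid : SpacerLang V (y :: (List.replicate (j + i + 1) (!y) ++ [y])) := by
    refine ⟨1, ?_⟩
    have := hS.cons_replicate_mid hpre hsuf (!y)
    rwa [← List.cons_append (a := !y), ← List.replicate_succ, ← List.append_assoc,
      List.replicate_append_replicate, ← add_assoc] at this
  have hrun : ∀ k, k ≤ j + i + 1 → SpacerLang V (List.replicate k (!y) ++ [y]) := by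
    intro k hk
    refine hmid.of_infix ⟨y :: List.replicate (j + i + 1 - k) (!y), [], ?_⟩
    rw [List.append_nil, List.cons_append, ← List.append_assoc,
      List.replicate_append_replicate, Nat.sub_add_cancel hk]
  have hrun' : ∀ k, k ≤ j + i + 1 → SpacerLang V (y :: List.replicate k (!y)) := by
    intro k hk
    refine hmid.of_infix ⟨[], List.replicate (j + i + 1 - k) (!y) ++ [y], ?_⟩
    rw [List.nil_append, List.cons_append, ← List.append_assoc,
      List.replicate_append_replicate, Nat.add_sub_cancel' hk]
  rcases hji.lt_or_eq with hlt | rfl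
  · have hsub : (!y) :: List.replicate j (!y) <:+ List.replicate (2 * j + 1) (!y) :=
      ⟨List.replicate j (!y), by
        rw [← List.replicate_succ, List.replicate_append_replicate]; congr 1; omega⟩
    have g := hS.gain (m := 0) (x := !y)
      (rightSpecial_of_not y (hrun (2 * j + 1) (by omega)) ((hrun (2 * j + 2) (by omega)).of_infix
        ⟨[], [y], by simp [← List.replicate_succ']⟩))
      hsub ⟨a, by simpa using hsuf.symm⟩
      (spell_suffix B d ((List.suffix_cons _ _).trans hsub)).length_le le_rfl
    have m1 := hS.wordCount_mono (block_suffix_spell B d (List.replicate j (!y))).length_le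
    refine ⟨_, (block_suffix_spell B d (List.replicate (2 * j + 1) (!y))).length_le, ?_⟩
    have e : 2 * (spell B d (List.replicate j (!y))).length ≤
        (spell B d (List.replicate (2 * j + 1) (!y))).length := by
      simp only [length_spell_replicate]
      nlinarith
    omega
  by_cases hB : ∃ k < j, SpacerLang V (y :: (List.replicate k (!y) ++ [y]))
  · obtain ⟨k, hk, hky⟩ := hB
    have g1 := hS.gain (m := 0) (x := y) (z := List.replicate k (!y))
      (q := (spell B d (List.replicate k (!y))).length + B.length)
      (rightSpecial_of_not y hky (by
        simpa [← List.replicate_succ'] using hrun' (k + 1) (by omega)))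
      List.suffix_rfl ⟨a ++ y :: List.replicate (j - (k + 1)) (!y), by
        rw [hsuf, ← List.replicate_succ, List.append_assoc, List.cons_append,
          List.replicate_append_replicate]
        congr 3
        omega⟩ (by omega) (by simp [spell]; omega)
    have hsub : (!y) :: List.replicate j (!y) <:+ List.replicate (2 * j) (!y) :=
      ⟨List.replicate (j - 1) (!y), by
        rw [← List.replicate_succ, List.replicate_append_replicate]; congr 1; omega⟩
    have g2 := hS.gain (m := 0) (x := !y)
      (rightSpecial_of_not y (hrun (2 * j) (by omega))
        ((hrun' (2 * j + 1) (by omega)).of_infix ⟨[y], [], by simp [List.replicate_succ']⟩))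
      hsub ⟨a, by simpa using hsuf.symm⟩
      (spell_suffix B d ((List.suffix_cons _ _).trans hsub)).length_le le_rfl
    have m1 := hS.wordCount_mono (block_suffix_spell B d (List.replicate k (!y))).length_le
    have m2 := hS.wordCount_mono
      (a := (spell B d (List.replicate k (!y))).length + B.length)
      (b := (spell B d (List.replicate j (!y))).length) (by
        simp only [length_spell_replicate]
        obtain ⟨e, rfl⟩ := Nat.exists_eq_add_of_lt hk
        nlinarith [Nat.zero_le (e * B.length), Nat.zero_le (e * (spacer d (!y)).length)])
    refine ⟨_, (block_suffix_spell B d (List.replicate (2 * j) (!y))).length_le, ?_⟩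
    have e : 2 * (spell B d (List.replicate j (!y))).length ≤
        (spell B d (List.replicate (2 * j) (!y))).length + B.length := by
      simp only [length_spell_replicate]
      nlinarith
    omega
  push Not at hB
  exact hS.fastGrowth_of_gaps hj hB hpre hsuf

theorem fastGrowth (hS : IsTowerSystem B d V t₁ t₂) : FastGrowth B d V (t₁ + t₂ + 1) := by
  by_cases hE : ∀ y, SpacerLang V [y, y]
  · obtain ⟨y, a, k, hk, h⟩ : ∃ y a k, 1 ≤ k ∧ V 0 = a ++ y :: List.replicate k (!y) := by
      obtain ⟨a, k, h⟩ := eq_append_run_of_mem (hS.tower.mem_zero true)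
      obtain ⟨a', k', h'⟩ := eq_append_run_of_mem (hS.tower.mem_zero false)
      rcases Nat.eq_zero_or_pos k with rfl | hk
      · rcases Nat.eq_zero_or_pos k' with rfl | hk'
        · simpa using h.symm.trans h'
        · exact ⟨false, a', k', hk', h'⟩
      · exact ⟨true, a, k, hk, h⟩
    obtain ⟨k, rfl⟩ := Nat.exists_eq_add_of_le' hk
    have g := hS.gain (m := 0) (x := y) (z := []) (w := [y]) (q := 2 * B.length)
      (rightSpecial_of_not y (hE y)
        ⟨0, a, List.replicate k (!y), by simp [h, List.replicate_succ]⟩) List.suffix_rfl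
      ⟨a ++ y :: List.replicate k (!y), by simp [h, List.replicate_succ']⟩
      (by simp [spell]; omega) (by simp [spell]; omega)
    refine ⟨2 * B.length, by omega, ?_⟩
    simp only [spell] at g
    omega
  · push Not at hE
    obtain ⟨y, hy⟩ := hE
    obtain ⟨a, j, hsuf⟩ := eq_append_run_of_mem (hS.tower.mem_zero y)
    obtain ⟨b, i, hpre⟩ := eq_run_append_of_mem (hS.tower.mem_zero y)
    have hmid := hS.cons_replicate_mid hpre hsuf y
    have hj : 1 ≤ j := by
      refine Nat.one_le_iff_ne_zero.2 fun h => hy ⟨1, List.IsInfix.trans ?_ hmid⟩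
      exact ⟨[], List.replicate i (!y) ++ [y], by simp [h]⟩
    have hi : 1 ≤ i := by
      refine Nat.one_le_iff_ne_zero.2 fun h => hy ⟨1, List.IsInfix.trans ?_ hmid⟩
      exact ⟨y :: List.replicate j (!y), [], by simp [h]⟩
    rcases le_total j i with hji | hij
    · exact hS.fastGrowth_of_le hj hji hpre hsuf
    · rw [add_comm t₁ t₂]
      exact FastGrowth.of_reverse (hS.reverse.fastGrowth_of_le (y := y) hi hij
        (b := a.reverse) (by simp [hsuf]) (a := b.reverse) (by simp [hpre]))

end IsTowerSystem

end Tower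

/-! ### The tower of a rank-one word sequence -/

/-- Copies of the word `w`, separated by the given letters. -/
def interleave (w : List Bool) : List Bool → List Bool
  | [] => w
  | c :: cs => w ++ c :: interleave w cs

theorem prefix_interleave (w cs : List Bool) : w <+: interleave w cs := by
  cases cs with
  | nil => exact List.prefix_rfl
  | cons c cs => exact List.prefix_append _ _

theorem suffix_interleave (w cs : List Bool) : w <:+ interleave w cs := by
  induction cs with
  | nil => exact List.suffix_rfl
  | cons c cs ih => exact ih.trans ⟨w ++ [c], by simp [interleave]⟩

theorem infix_interleave (w : List Bool) {c : Bool} {cs : List Bool} (hc : c ∈ cs) :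
    w ++ c :: w <:+: interleave w cs := by
  induction cs with
  | nil => simp at hc
  | cons e cs ih =>
    rcases List.mem_cons.1 hc with rfl | hc
    · obtain ⟨b, hb⟩ := prefix_interleave w cs
      exact ⟨[], b, by simp [interleave, ← hb]⟩
    · exact (ih hc).trans (List.IsSuffix.isInfix ⟨w ++ [e], by simp [interleave]⟩)

theorem spell_interleave (B : List Bool) (d : ℕ) (w cs : List Bool) :
    spell B d (interleave w cs) = spell (spell B d w) d cs := by
  induction cs with
  | nil => rfl
  | cons c cs ih => simp [interleave, spell_append, ih, spell]

/-- The letters recording which of the first `r k` spacers of stage `k` are nonempty. -/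
def stageWord (r : ℕ → ℕ) (s : ℕ → ℕ → ℕ) (k : ℕ) : List Bool :=
  (List.range (r k)).map fun i => decide (s k i ≠ 0)

/-- `spacerTower r s n m` is the word of spacers between the copies of stage `n` in
stage `n + m + 1`. -/
def spacerTower (r : ℕ → ℕ) (s : ℕ → ℕ → ℕ) (n : ℕ) : ℕ → List Bool
  | 0 => stageWord r s n
  | m + 1 => interleave (spacerTower r s n m) (stageWord r s (n + m + 1))

theorem flatten_blocks_append (B : List Bool) (d : ℕ) (f : ℕ → ℕ) (k : ℕ)
    (hf : ∀ i < k, f i = 0 ∨ f i = d) (hd : 1 ≤ d) :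
    ((List.range k).map fun i => B ++ List.replicate (f i) true).flatten ++ B =
      spell B d ((List.range k).map fun i => decide (f i ≠ 0)) := by
  induction k with
  | zero => simp [spell]
  | succ k ih =>
    have hk : List.replicate (f k) true = spacer d (decide (f k ≠ 0)) := by
      rcases hf k (by omega) with h | h
      · simp [h, spacer]
      · simp [h, spacer, show d ≠ 0 by omega]
    rw [List.range_succ, List.map_append, List.map_append, List.flatten_append]
    simp only [List.map_cons, List.map_nil, List.flatten_cons, List.flatten_nil,
      List.append_nil]
    rw [spell_append, ← ih fun i hi => hf i (by omega), hk]
    simp [spell]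

section Bseq

variable {r : ℕ → ℕ} {s : ℕ → ℕ → ℕ} {d N : ℕ}

theorem Bseq_prefix_succ (n : ℕ) : Bseq r s n <+: Bseq r s (n + 1) := by
  cases n with
  | zero => exact List.prefix_rfl
  | succ n =>
    rw [Bseq, List.range_succ_eq_map]
    simp

theorem Bseq_prefix_of_le {m n : ℕ} (h : m ≤ n) : Bseq r s m <+: Bseq r s n := by
  induction n, h using Nat.le_induction with
  | base => exact List.prefix_rfl
  | succ n _ ih => exact ih.trans (Bseq_prefix_succ n)

theorem singleton_prefix_Bseq (n : ℕ) : [false] <+: Bseq r s n :=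
  Bseq_prefix_of_le (Nat.zero_le n)

theorem Bseq_succ_eq_spell (hd : 1 ≤ d) {n : ℕ} (hn : 1 ≤ n)
    (h0 : ∀ i, i < r n → s n i = 0 ∨ s n i = d) (h1 : s n (r n) = 0) :
    Bseq r s (n + 1) = spell (Bseq r s n) d (stageWord r s n) := by
  obtain ⟨n, rfl⟩ := Nat.exists_eq_add_of_le' hn
  rw [stageWord, ← flatten_blocks_append _ d (s (n + 1)) _ h0 hd, Bseq, List.range_succ]
  simp [h1]

theorem Bseq_add_eq_spell (hd : 1 ≤ d) (hN : 1 ≤ N)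
    (h0 : ∀ n, N ≤ n → ∀ i, i < r n → s n i = 0 ∨ s n i = d) (h1 : ∀ n, N ≤ n → s n (r n) = 0)
    {n : ℕ} (hn : N ≤ n) (m : ℕ) :
    Bseq r s (n + m + 1) = spell (Bseq r s n) d (spacerTower r s n m) := by
  induction m with
  | zero => exact Bseq_succ_eq_spell hd (hN.trans hn) (h0 n hn) (h1 n hn)
  | succ m ih =>
    rw [spacerTower, spell_interleave, ← ih]
    exact Bseq_succ_eq_spell hd (by omega) (h0 _ (by omega)) (h1 _ (by omega))

theorem isTower_spacerTower (h : ∀ n, N ≤ n → ∀ c, c ∈ stageWord r s n) {n : ℕ} (hn : N ≤ n) :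
    IsTower (spacerTower r s n) where
  prefix_succ m := prefix_interleave _ _
  suffix_succ m := suffix_interleave _ _
  mid m c := infix_interleave _ (h _ (by omega) c)
  mem_zero c := h n hn c

end Bseq

end RankOne

open RankOne

/-- If for all `n ≥ N` the spacers satisfy `s_{n,i} ∈ {0,d}` (`0 ≤ i < r_n`),
`s_{n,r_n} = 0`, and both values occur (with `d ≥ 1`), then there is a constant `C` such
that for all sufficiently large `n` there exists `q_n ≥ h_n` with
`p(q_n) ≥ 1.5 q_n + (p(h_n) - h_n) - C`. -/
theorem stmt11 (r : ℕ → ℕ) (s : ℕ → ℕ → ℕ) (hr : ∀ n, 1 ≤ r n)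
    (d : ℕ) (hd : 1 ≤ d) (N : ℕ) (hN : 1 ≤ N)
    (hyp : ∀ n, N ≤ n →
      (∀ i, i < r n → s n i = 0 ∨ s n i = d) ∧
      s n (r n) = 0 ∧
      (∃ i, i < r n ∧ s n i = 0) ∧ (∃ i, i < r n ∧ s n i = d)) :
    ∃ C : ℝ, ∃ M : ℕ, ∀ n, M ≤ n → ∃ q : ℕ, (Bseq r s n).length ≤ q ∧
      (3 / 2 : ℝ) * q + ((complexity r s (Bseq r s n).length : ℝ) -
          ((Bseq r s n).length : ℝ)) - C ≤ (complexity r s q : ℝ) := by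
  obtain ⟨a, t, hat⟩ := eq_append_run_of_mem
    ((singleton_prefix_Bseq (r := r) (s := s) N).subset List.mem_cons_self)
  have hspell := fun n (hn : N ≤ n) => Bseq_add_eq_spell (n := n) hd hN
    (fun n hn => (hyp n hn).1) (fun n hn => (hyp n hn).2.1) hn
  refine ⟨2 * (t + 1), N, fun n hn => ?_⟩
  have hS : IsTowerSystem (Bseq r s n) d (spacerTower r s n) 0 t := by
    refine ⟨isTower_spacerTower (fun n hn c => ?_) hn, hd,
      by simpa using singleton_prefix_Bseq n, ?_⟩
    · obtain ⟨-, -, ⟨i, hi, hi0⟩, j, hj, hjd⟩ := hyp n hn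
      rw [stageWord, List.mem_map]
      cases c with
      | false => exact ⟨i, List.mem_range.2 hi, by simp [hi0]⟩
      | true => exact ⟨j, List.mem_range.2 hj, by simp [hjd]; omega⟩
    · have hsuf : Bseq r s N <:+ Bseq r s n := by
        obtain ⟨m, rfl⟩ := Nat.exists_eq_add_of_le hn
        cases m with
        | zero => exact List.suffix_rfl
        | succ m => exact hspell N le_rfl m ▸ block_suffix_spell _ _ _
      exact List.IsSuffix.trans ⟨a, by simpa using hat.symm⟩ hsuf
  have hlang : TowerLang (Bseq r s n) d (spacerTower r s n) = InLang r s := by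
    funext w
    refine propext ⟨fun ⟨m, hm⟩ => ⟨n + m + 1, by rwa [hspell n hn m]⟩, fun ⟨m, hm⟩ => ⟨m, ?_⟩⟩
    rw [← hspell n hn m]
    exact hm.trans (Bseq_prefix_of_le (by omega)).isInfix
  obtain ⟨q, hq, h⟩ := hS.fastGrowth
  refine ⟨q, hq, ?_⟩
  rw [hlang] at h
  change 3 * q + 2 * complexity r s _ ≤ 2 * complexity r s q + _ + _ at h
  have h' : (3 * q + 2 * complexity r s (Bseq r s n).length : ℝ) ≤
      2 * complexity r s q + 2 * (Bseq r s n).length + 4 * (0 + t + 1) := mod_cast h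
  linarith
end
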